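/- Let τ_D > 0 and N₀ ∈ ℕ, and let {(x_k,σ_k)} be a uniformly precompact sequence of trajectories of the switched system ẋ = f(x,σ) such that σ_k ∈ S_a[τ_D,N₀] and [−k,∞) ⊆ I_{x_k} for all k ∈ ℕ. Then there exist a subsequence {(x_{k_l},σ_{k_l})} and a complete trajectory (x*,σ*) ∈ T_a[τ_D,N₀] such that: (1) x_{k_l} → x* uniformly on compact subsets of ℝ; (2) σ_{k_l}(t) → σ*(t) for almost all t ∈ ℝ. -/

import Mathlib

open Filter Topology MeasureTheory Set

noncomputable section

abbrev Eucl (n : ℕ) : Type := EuclideanSpace ℝ (Fin n)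

/-- The set of discontinuity (switching) times of a signal. -/
def JumpTimes {Γ : Type*} [TopologicalSpace Γ] (σ : ℝ → Γ) : Set ℝ :=
  {t | ¬ ContinuousAt σ t}

/-- A switching signal: piecewise constant (finitely many discontinuities in every
compact interval, locally constant to the right and on a left punctured neighborhood
of every point) and continuous from the right. -/
structure IsSwitchingSignal {Γ : Type*} [TopologicalSpace Γ] (σ : ℝ → Γ) : Prop where
  locFinite : ∀ a b : ℝ, (JumpTimes σ ∩ Set.Icc a b).Finite
  rightConst : ∀ t : ℝ, ∃ ε > (0:ℝ), ∀ s ∈ Set.Ico t (t + ε), σ s = σ t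
  leftConst : ∀ t : ℝ, ∃ ε > (0:ℝ), ∀ s ∈ Set.Ioo (t - ε) t, ∀ s' ∈ Set.Ioo (t - ε) t, σ s = σ s'

/-- `SA Γ τD N₀` : switching signals with average dwell time `τD` and chatter bound `N₀`. -/
def SA (Γ : Type*) [TopologicalSpace Γ] (τD : ℝ) (N₀ : ℕ) : Set (ℝ → Γ) :=
  {σ | IsSwitchingSignal σ ∧ ∀ τ₁ τ₂ : ℝ, τ₁ < τ₂ →
    ((JumpTimes σ ∩ Set.Ioo τ₁ τ₂).ncard : ℝ) ≤ (N₀ : ℝ) + (τ₂ - τ₁) / τD}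

def SAall (Γ : Type*) [TopologicalSpace Γ] : Set (ℝ → Γ) :=
  ⋃ τD ∈ Set.Ioi (0 : ℝ), ⋃ N₀ : ℕ, SA Γ τD N₀

/-- Dwell-time signals. -/
def SD (Γ : Type*) [TopologicalSpace Γ] (τD : ℝ) : Set (ℝ → Γ) := SA Γ τD 1

def SDall (Γ : Type*) [TopologicalSpace Γ] : Set (ℝ → Γ) :=
  ⋃ τD ∈ Set.Ioi (0 : ℝ), SD Γ τD

/-- First switching time strictly greater than `t` (`⊤` if none). -/
def tau1 {Γ : Type*} [TopologicalSpace Γ] (σ : ℝ → Γ) (t : ℝ) : EReal :=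
  sInf (Real.toEReal '' (JumpTimes σ ∩ Set.Ioi t))

/-- The class `S^H` of switching signals compatible with the set-valued map `H`:
at each switching time the new value belongs to `H` of the left limit. -/
def SH {Γ : Type*} [TopologicalSpace Γ] (H : Γ → Set Γ) : Set (ℝ → Γ) :=
  {σ | ∀ t ∈ JumpTimes σ, ∀ γ' : Γ,
    Filter.Tendsto σ (nhdsWithin t (Set.Iio t)) (nhds γ') → σ t ∈ H γ'}

/-- The "ergodic" class `S_e[T]`. -/
def SE (Γ : Type*) [TopologicalSpace Γ] (T : ℝ) : Set (ℝ → Γ) :=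
  {σ | ∀ t₀ : ℝ, 0 ≤ t₀ → ∀ γ : Γ, ∃ t ∈ Set.Icc t₀ (t₀ + T), σ t = γ}

def SEall (Γ : Type*) [TopologicalSpace Γ] : Set (ℝ → Γ) :=
  ⋃ T ∈ Set.Ioi (0 : ℝ), SE Γ T

/-- Property P of a family of switching signals. -/
def HasPropertyP {Γ : Type*} [TopologicalSpace Γ] (S : Set (ℝ → Γ)) : Prop :=
  (∃ τD > (0 : ℝ), ∃ N₀ : ℕ, S ⊆ SA Γ τD N₀) ∧
  (∀ σ ∈ S, ∀ s > (0 : ℝ), (fun t => σ (t + s)) ∈ S) ∧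
  (∀ σseq : ℕ → ℝ → Γ, (∀ k, σseq k ∈ S) →
    ∃ σstar ∈ S, ∃ φ : ℕ → ℕ, StrictMono φ ∧
      ∀ᵐ t ∂(volume : Measure ℝ),
        Filter.Tendsto (fun l => σseq (φ l) t) Filter.atTop (nhds (σstar t)))

/-- A solution of `ẋ = g(x)` with values in `X`, on the set `I`. -/
def IsSolOn {n : ℕ} (g : Eucl n → Eucl n) (X : Set (Eucl n)) (φ : ℝ → Eucl n) (I : Set ℝ) : Prop :=
  ContinuousOn φ I ∧ (∀ t ∈ I, φ t ∈ X) ∧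
  ∀ t₀ ∈ I, ∀ t ∈ I,
    IntervalIntegrable (fun s => g (φ s)) volume t₀ t ∧
    φ t = φ t₀ + ∫ s in t₀..t, g (φ s)

/-- A trajectory of the switched system `ẋ = f(x,σ)` on the interval `I`. -/
structure IsTrajectory {n : ℕ} {Γ : Type*} [TopologicalSpace Γ]
    (f : Eucl n × Γ → Eucl n) (domf : Set (Eucl n × Γ))
    (x : ℝ → Eucl n) (σ : ℝ → Γ) (I : Set ℝ) : Prop where
  signal : IsSwitchingSignal σ
  nonempty : I.Nonempty
  ordConn : I.OrdConnected
  cont : ContinuousOn x I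
  mem : ∀ t ∈ I, (x t, σ t) ∈ domf
  intg : ∀ t₀ ∈ I, ∀ t ∈ I,
    IntervalIntegrable (fun s => f (x s, σ s)) volume t₀ t ∧
    x t = x t₀ + ∫ s in t₀..t, f (x s, σ s)

/-- Precompactness of a trajectory relative to `O`. -/
def PrecompactRel {n : ℕ} (x : ℝ → Eucl n) (I : Set ℝ) (O : Set (Eucl n)) : Prop :=
  ∃ B : Set (Eucl n), B ⊆ O ∧ IsCompact B ∧ ∀ t ∈ I, x t ∈ B

/-- ω-limit set of `x` defined on `I`. -/
def OmegaLimit {n : ℕ} (x : ℝ → Eucl n) (I : Set ℝ) : Set (Eucl n) :=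
  {ξ | ∃ s : ℕ → ℝ, StrictMono s ∧ (∀ k, s k ∈ I) ∧
    Filter.Tendsto s Filter.atTop Filter.atTop ∧
    Filter.Tendsto (fun k => x (s k)) Filter.atTop (nhds ξ)}

/-- The set `Ω♯(x,σ)`. -/
def OmegaSharp {n : ℕ} {Γ : Type*} [TopologicalSpace Γ] (x : ℝ → Eucl n) (σ : ℝ → Γ) :
    Set (Eucl n × Γ) :=
  {p | ∃ s : ℕ → ℝ, StrictMono s ∧ (∀ k, 0 ≤ s k) ∧
    Filter.Tendsto s Filter.atTop Filter.atTop ∧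
    (∃ r : EReal, 0 < r ∧
      Filter.Tendsto (fun k => tau1 σ (s k) - Real.toEReal (s k)) Filter.atTop (nhds r)) ∧
    Filter.Tendsto (fun k => x (s k)) Filter.atTop (nhds p.1) ∧
    Filter.Tendsto (fun k => σ (s k)) Filter.atTop (nhds p.2)}

/-- Weak invariance of `M` w.r.t. the family of complete trajectories `T`
(without the nonemptiness requirement). -/
def WeaklyInvariantCore {n : ℕ} {Γ : Type*} (T : Set ((ℝ → Eucl n) × (ℝ → Γ)))
    (M : Set (Eucl n × Γ)) : Prop :=
  ∀ p ∈ M, ∃ xs ∈ T, xs.1 0 = p.1 ∧ xs.2 0 = p.2 ∧ ∀ t : ℝ, (xs.1 t, xs.2 t) ∈ M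

/-- Weak invariance of a nonempty set `M` w.r.t. `T`. -/
def WeaklyInvariant {n : ℕ} {Γ : Type*} (T : Set ((ℝ → Eucl n) × (ℝ → Γ)))
    (M : Set (Eucl n × Γ)) : Prop :=
  M.Nonempty ∧ WeaklyInvariantCore T M

/-- Maximal weakly invariant subset of `S` w.r.t. `T`. -/
def MaxWeaklyInvariantIn {n : ℕ} {Γ : Type*} (T : Set ((ℝ → Eucl n) × (ℝ → Γ)))
    (S : Set (Eucl n × Γ)) : Set (Eucl n × Γ) :=
  ⋃₀ {M | M ⊆ S ∧ WeaklyInvariantCore T M}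

/-- All complete trajectories whose switching signal lies in `S`. -/
def TrajOf {n : ℕ} {Γ : Type*} [TopologicalSpace Γ] (f : Eucl n × Γ → Eucl n)
    (domf : Set (Eucl n × Γ)) (S : Set (ℝ → Γ)) : Set ((ℝ → Eucl n) × (ℝ → Γ)) :=
  {xs | IsTrajectory f domf xs.1 xs.2 Set.univ ∧ xs.2 ∈ S}

/-- `x → M` : convergence of `x(t)` to the set `M` as `t → +∞`. -/
def ConvergesTo {n : ℕ} (x : ℝ → Eucl n) (M : Set (Eucl n)) : Prop :=
  Filter.Tendsto (fun t => Metric.infDist (x t) M) Filter.atTop (nhds 0)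

def Oset {n : ℕ} {Γ : Type*} (domV : Set (Eucl n × Γ)) : Set (Eucl n) := Prod.fst '' domV

def Ogamma {n : ℕ} {Γ : Type*} (domV domf : Set (Eucl n × Γ)) (γ : Γ) : Set (Eucl n) :=
  {ξ | ξ ∈ Oset domV ∧ (ξ, γ) ∈ domf}

/-- The class 𝒱 of functions. -/
structure ClassVFun {n : ℕ} {Γ : Type*} (V : Eucl n × Γ → ℝ)
    (domV domf : Set (Eucl n × Γ)) : Prop where
  openD : ∀ γ : Γ, IsOpen {ξ : Eucl n | (ξ, γ) ∈ domV}
  subD : ∀ γ : Γ, ∀ ξ ∈ Ogamma domV domf γ, (ξ, γ) ∈ domV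
  diff : ∀ γ : Γ, ∀ ξ ∈ Ogamma domV domf γ, DifferentiableAt ℝ (fun ξ' => V (ξ', γ)) ξ

/-- The set `Z_V`. -/
def ZV {n : ℕ} {Γ : Type*} (f : Eucl n × Γ → Eucl n) (V : Eucl n × Γ → ℝ)
    (domV domf : Set (Eucl n × Γ)) : Set (Eucl n × Γ) :=
  {p | p ∈ domf ∧ p.1 ∈ Oset domV ∧ fderiv ℝ (fun ξ' => V (ξ', p.2)) p.1 (f p) = 0}

/-- Assumption (A1). -/
structure AssumptionA1 {n : ℕ} {Γ : Type*} [TopologicalSpace Γ]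
    (domf : Set (Eucl n × Γ)) (V : Eucl n × Γ → ℝ) (domV : Set (Eucl n × Γ))
    (x : ℝ → Eucl n) (σ : ℝ → Γ) (I : Set ℝ) : Prop where
  classV : ClassVFun V domV domf
  contV : ContinuousOn V (domf ∩ (Oset domV ×ˢ (Set.univ : Set Γ)))
  precompact : PrecompactRel x I (Oset domV)
  nonincr : AntitoneOn (fun t => V (x t, σ t)) (Set.Ici 0)

/-- Assumption (A2) (for finite Γ). -/
structure AssumptionA2 {n : ℕ} {Γ : Type*} [TopologicalSpace Γ]
    (domf : Set (Eucl n × Γ)) (V : Eucl n × Γ → ℝ) (domV : Set (Eucl n × Γ))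
    (x : ℝ → Eucl n) (σ : ℝ → Γ) (I : Set ℝ) : Prop where
  classV : ClassVFun V domV domf
  precompact : PrecompactRel x I (Oset domV)
  nonincr : ∀ γ : Γ, AntitoneOn (fun t => V (x t, σ t)) ({t | σ t = γ} ∩ Set.Ici 0)

/-- The inequality `−∇V_γ(ξ)·f_γ(ξ) ≥ W_γ(ξ) ≥ 0` on each `O_γ`. -/
def Wineq {n : ℕ} {Γ : Type*} (f : Eucl n × Γ → Eucl n) (V W : Eucl n × Γ → ℝ)
    (domV domf : Set (Eucl n × Γ)) : Prop :=
  ∀ γ : Γ, ∀ ξ ∈ Ogamma domV domf γ,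
    W (ξ, γ) ≤ -(fderiv ℝ (fun ξ' => V (ξ', γ)) ξ (f (ξ, γ))) ∧ 0 ≤ W (ξ, γ)

/-- Assumption (A4). -/
structure AssumptionA4 {n : ℕ} {Γ : Type*} [TopologicalSpace Γ] (f : Eucl n × Γ → Eucl n)
    (domf : Set (Eucl n × Γ)) (V : Eucl n × Γ → ℝ) (domV : Set (Eucl n × Γ))
    (W : Eucl n × Γ → ℝ) (x : ℝ → Eucl n) (σ : ℝ → Γ) (I : Set ℝ) : Prop where
  classV : ClassVFun V domV domf
  boundedV : ∀ K : Set (Eucl n × Γ), K ⊆ domf ∩ (Oset domV ×ˢ (Set.univ : Set Γ)) →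
    IsCompact K → ∃ M : ℝ, ∀ p ∈ K, |V p| ≤ M
  precompact : PrecompactRel x I (Oset domV)
  nonincr : AntitoneOn (fun t => V (x t, σ t)) (Set.Ici 0)
  wineq : Wineq f V W domV domf
  contW : ContinuousOn W (domf ∩ (Oset domV ×ˢ (Set.univ : Set Γ)))

/-- The set `X^f(g,h,τ)` for finite `τ`. -/
def XFwd {n : ℕ} (X : Set (Eucl n)) (g : Eucl n → Eucl n) (h : Eucl n → ℝ) (τ : ℝ) :
    Set (Eucl n) :=
  {ξ | ∃ φ : ℝ → Eucl n, IsSolOn g X φ (Set.Icc 0 τ) ∧ φ 0 = ξ ∧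
    ∀ t ∈ Set.Icc (0 : ℝ) τ, h (φ t) = 0}

/-- The set `X^b(g,h,τ)` for finite `τ`. -/
def XBwd {n : ℕ} (X : Set (Eucl n)) (g : Eucl n → Eucl n) (h : Eucl n → ℝ) (τ : ℝ) :
    Set (Eucl n) :=
  {ξ | ∃ φ : ℝ → Eucl n, IsSolOn g X φ (Set.Icc (-τ) 0) ∧ φ 0 = ξ ∧
    ∀ t ∈ Set.Icc (-τ) (0 : ℝ), h (φ t) = 0}

/-- The set `X^f(g,h,∞)`. -/
def XFwdInf {n : ℕ} (X : Set (Eucl n)) (g : Eucl n → Eucl n) (h : Eucl n → ℝ) :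
    Set (Eucl n) :=
  {ξ | ∃ φ : ℝ → Eucl n, IsSolOn g X φ (Set.Ici 0) ∧ φ 0 = ξ ∧
    ∀ t ∈ Set.Ici (0 : ℝ), h (φ t) = 0}

/-- The set `X^b(g,h,∞)`. -/
def XBwdInf {n : ℕ} (X : Set (Eucl n)) (g : Eucl n → Eucl n) (h : Eucl n → ℝ) :
    Set (Eucl n) :=
  {ξ | ∃ φ : ℝ → Eucl n, IsSolOn g X φ (Set.Iic 0) ∧ φ 0 = ξ ∧
    ∀ t ∈ Set.Iic (0 : ℝ), h (φ t) = 0}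

/-- `X^f(g,h) = ∪_{τ>0} X^f(g,h,τ)`. -/
def XFwdFin {n : ℕ} (X : Set (Eucl n)) (g : Eucl n → Eucl n) (h : Eucl n → ℝ) :
    Set (Eucl n) :=
  ⋃ τ ∈ Set.Ioi (0 : ℝ), XFwd X g h τ

/-- `X^b(g,h) = ∪_{τ>0} X^b(g,h,τ)`. -/
def XBwdFin {n : ℕ} (X : Set (Eucl n)) (g : Eucl n → Eucl n) (h : Eucl n → ℝ) :
    Set (Eucl n) :=
  ⋃ τ ∈ Set.Ioi (0 : ℝ), XBwd X g h τ

/-- Weakly meagre functions on `[0,∞)`. -/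
def WeaklyMeagre (y : ℝ → ℝ) : Prop :=
  ∀ I : ℕ → Set ℝ, (∀ k, (I k).Nonempty) → (∀ k, I k ⊆ Set.Ici 0) →
    (∀ k, (I k).OrdConnected) → (Pairwise fun k l => Disjoint (I k) (I l)) →
    (∃ δ : ENNReal, 0 < δ ∧ ∀ k, δ ≤ volume (I k)) →
    Filter.Tendsto (fun k => sInf ((fun t => |y t|) '' I k)) Filter.atTop (nhds 0)

/-- Assumption (E0) : the origin is an equilibrium point of the switched system. -/
def AssumpE0 {n : ℕ} {Γ : Type*} (f : Eucl n × Γ → Eucl n) (domf : Set (Eucl n × Γ)) : Prop :=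
  ∀ γ : Γ, ((0 : Eucl n), γ) ∈ domf → f (0, γ) = 0

/-- Assumption (U) : uniqueness of the solution of the IVP `ẋ = f_γ(x)`, `x(0)=0`. -/
def AssumpU {n : ℕ} {Γ : Type*} (f : Eucl n × Γ → Eucl n) (domf : Set (Eucl n × Γ)) : Prop :=
  ∀ γ : Γ, ((0 : Eucl n), γ) ∈ domf →
    ∀ I : Set ℝ, I.OrdConnected → (0 : ℝ) ∈ I →
    ∀ φ ψ : ℝ → Eucl n,
      IsSolOn (fun ξ => f (ξ, γ)) {ξ | (ξ, γ) ∈ domf} φ I →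
      IsSolOn (fun ξ => f (ξ, γ)) {ξ | (ξ, γ) ∈ domf} ψ I →
      φ 0 = 0 → ψ 0 = 0 → ∀ t ∈ I, φ t = ψ t

/-- The set `E_γ` of equilibrium points of `f_γ`. -/
def Egamma {n : ℕ} {Γ : Type*} (f : Eucl n × Γ → Eucl n) (domf : Set (Eucl n × Γ)) (γ : Γ) :
    Set (Eucl n) :=
  {ξ | (ξ, γ) ∈ domf ∧ f (ξ, γ) = 0}

/-- Discrete subsets of `ℝⁿ`. -/
def IsDiscreteSet {n : ℕ} (S : Set (Eucl n)) : Prop :=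
  ∀ ξ ∈ S, ∃ ε > (0 : ℝ), S ∩ Metric.ball ξ ε = {ξ}

/-- Class-K functions (on `[0,∞)`). -/
structure ClassK (α : ℝ → ℝ) : Prop where
  cont : ContinuousOn α (Set.Ici 0)
  mono : StrictMonoOn α (Set.Ici 0)
  zero : α 0 = 0

/-- Class-K∞ functions. -/
structure ClassKInf (α : ℝ → ℝ) extends ClassK α : Prop where
  unbounded : Filter.Tendsto α Filter.atTop Filter.atTop

/-- Local uniform stability of a family of forward complete trajectories. -/
def FamilyLUS {n : ℕ} {Γ : Type*} (T : Set ((ℝ → Eucl n) × (ℝ → Γ))) : Prop :=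
  ∃ r > (0 : ℝ), ∃ α : ℝ → ℝ, ClassK α ∧
    ∀ xs ∈ T, ∀ t₀ : ℝ, 0 ≤ t₀ → ‖xs.1 t₀‖ ≤ r → ∀ t : ℝ, t₀ ≤ t → ‖xs.1 t‖ ≤ α ‖xs.1 t₀‖

/-- Global uniform stability. -/
def FamilyGUS {n : ℕ} {Γ : Type*} (T : Set ((ℝ → Eucl n) × (ℝ → Γ))) : Prop :=
  ∃ α : ℝ → ℝ, ClassKInf α ∧
    ∀ xs ∈ T, ∀ t₀ : ℝ, 0 ≤ t₀ → ∀ t : ℝ, t₀ ≤ t → ‖xs.1 t‖ ≤ α ‖xs.1 t₀‖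

/-- Local asymptotic stability. -/
def FamilyLAS {n : ℕ} {Γ : Type*} (T : Set ((ℝ → Eucl n) × (ℝ → Γ))) : Prop :=
  FamilyLUS T ∧ ∃ η > (0 : ℝ), ∀ xs ∈ T, ‖xs.1 0‖ < η →
    Filter.Tendsto xs.1 Filter.atTop (nhds 0)

/-- Global asymptotic stability. -/
def FamilyGAS {n : ℕ} {Γ : Type*} (T : Set ((ℝ → Eucl n) × (ℝ → Γ))) : Prop :=
  FamilyGUS T ∧ ∀ xs ∈ T, Filter.Tendsto xs.1 Filter.atTop (nhds 0)

/-- A weak Lyapunov pair `(V,W)` for the family `T`. -/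
structure WeakLyapunovPair {n : ℕ} {Γ : Type*} [TopologicalSpace Γ]
    (f : Eucl n × Γ → Eucl n) (domf : Set (Eucl n × Γ)) (V : Eucl n × Γ → ℝ)
    (domV : Set (Eucl n × Γ)) (W : Eucl n × Γ → ℝ)
    (T : Set ((ℝ → Eucl n) × (ℝ → Γ))) : Prop where
  classV : ClassVFun V domV domf
  zeroMem : (0 : Eucl n) ∈ Oset domV
  bounds : ∃ α₁ α₂ : ℝ → ℝ, ClassK α₁ ∧ ClassK α₂ ∧
    ∀ γ : Γ, ∀ ξ ∈ Ogamma domV domf γ, α₁ ‖ξ‖ ≤ V (ξ, γ) ∧ V (ξ, γ) ≤ α₂ ‖ξ‖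
  wineq : Wineq f V W domV domf
  decreasing : ∀ xs ∈ T, ∀ a b : ℝ, 0 ≤ a → a ≤ b →
    (∀ t ∈ Set.Icc a b, xs.1 t ∈ Oset domV) →
    AntitoneOn (fun t => V (xs.1 t, xs.2 t)) (Set.Icc a b)

/-- An F-weak Lyapunov pair `(V,W)` for the family `T`. -/
structure FWeakLyapunovPair {n : ℕ} {Γ : Type*} [TopologicalSpace Γ]
    (f : Eucl n × Γ → Eucl n) (domf : Set (Eucl n × Γ)) (V : Eucl n × Γ → ℝ)
    (domV : Set (Eucl n × Γ)) (W : Eucl n × Γ → ℝ)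
    (T : Set ((ℝ → Eucl n) × (ℝ → Γ))) : Prop where
  classV : ClassVFun V domV domf
  zeroMem : (0 : Eucl n) ∈ Oset domV
  bounds : ∃ α₁ α₂ : ℝ → ℝ, ClassK α₁ ∧ ClassK α₂ ∧
    ∀ γ : Γ, ∀ ξ ∈ Ogamma domV domf γ, α₁ ‖ξ‖ ≤ V (ξ, γ) ∧ V (ξ, γ) ≤ α₂ ‖ξ‖
  wineq : Wineq f V W domV domf
  decreasing : ∀ xs ∈ T, ∀ a b : ℝ, 0 ≤ a → a ≤ b →
    (∀ t ∈ Set.Icc a b, xs.1 t ∈ Oset domV) →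
    ∀ γ : Γ, AntitoneOn (fun t => V (xs.1 t, γ)) (Set.Icc a b ∩ {t | xs.2 t = γ})

/-- `V` is radially unbounded : the class-K bounds may be chosen of class K∞. -/
def RadiallyUnbounded {n : ℕ} {Γ : Type*} (V : Eucl n × Γ → ℝ)
    (domV domf : Set (Eucl n × Γ)) : Prop :=
  ∃ α₁ α₂ : ℝ → ℝ, ClassKInf α₁ ∧ ClassKInf α₂ ∧
    ∀ γ : Γ, ∀ ξ ∈ Ogamma domV domf γ, α₁ ‖ξ‖ ≤ V (ξ, γ) ∧ V (ξ, γ) ≤ α₂ ‖ξ‖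

/-- Simple cycle `{γ_i}_{i=1}^m` of the set-valued map `H`. -/
def IsSimpleCycle {Γ : Type*} (H : Γ → Set Γ) (m : ℕ) (γs : ℕ → Γ) : Prop :=
  3 ≤ m ∧ γs 1 = γs m ∧ (∀ i, 1 ≤ i → i < m → γs (i + 1) ∈ H (γs i)) ∧
  ∀ i j, 1 ≤ i → i < j → j ≤ m → γs i = γs j → i = 1 ∧ j = m

/-- A family of forward complete trajectories of the switched system. -/
def ForwardCompleteFamily {n : ℕ} {Γ : Type*} [TopologicalSpace Γ]
    (f : Eucl n × Γ → Eucl n) (domf : Set (Eucl n × Γ))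
    (T : Set ((ℝ → Eucl n) × (ℝ → Γ))) : Prop :=
  ∀ xs ∈ T, ∃ I : Set ℝ, Set.Ici (0 : ℝ) ⊆ I ∧ IsTrajectory f domf xs.1 xs.2 I

/-- Condition (a) : `O_γ^f(f_γ,W_γ,∞) ∩ O_γ^b(f_γ,W_γ,∞) ⊆ {0}` for every `γ`. -/
def CondA {n : ℕ} {Γ : Type*} (f : Eucl n × Γ → Eucl n)
    (domf domV : Set (Eucl n × Γ)) (W : Eucl n × Γ → ℝ) : Prop :=
  ∀ γ : Γ, XFwdInf (Ogamma domV domf γ) (fun ξ => f (ξ, γ)) (fun ξ => W (ξ, γ)) ∩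
    XBwdInf (Ogamma domV domf γ) (fun ξ => f (ξ, γ)) (fun ξ => W (ξ, γ)) ⊆ {0}

/-- Condition (b) : `O_γ^b(f_γ,W_γ) ∩ O_{γ'}^f(f_{γ'},W_{γ'}) ⊆ {0}` for `γ ≠ γ'`. -/
def CondB {n : ℕ} {Γ : Type*} (f : Eucl n × Γ → Eucl n)
    (domf domV : Set (Eucl n × Γ)) (W : Eucl n × Γ → ℝ) : Prop :=
  ∀ γ γ' : Γ, γ ≠ γ' →
    XBwdFin (Ogamma domV domf γ) (fun ξ => f (ξ, γ)) (fun ξ => W (ξ, γ)) ∩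
    XFwdFin (Ogamma domV domf γ') (fun ξ => f (ξ, γ')) (fun ξ => W (ξ, γ')) ⊆ {0}

/-- Condition (b') : the variant of (b) involving the level sets of `V`. -/
def CondB' {n : ℕ} {Γ : Type*} (f : Eucl n × Γ → Eucl n) (V : Eucl n × Γ → ℝ)
    (domf domV : Set (Eucl n × Γ)) (W : Eucl n × Γ → ℝ) : Prop :=
  ∀ γ γ' : Γ, γ ≠ γ' → ∀ c : ℝ,
    XBwdFin (Ogamma domV domf γ) (fun ξ => f (ξ, γ)) (fun ξ => W (ξ, γ)) ∩
    XFwdFin (Ogamma domV domf γ') (fun ξ => f (ξ, γ')) (fun ξ => W (ξ, γ')) ∩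
    {ξ : Eucl n | V (ξ, γ) = c} ∩ {ξ : Eucl n | V (ξ, γ') = c} ⊆ {0}

/-- Condition (i) of the cycle theorems :
either all the forward infinite-horizon sets, or all the backward ones, reduce to `{0}`. -/
def CondI {n : ℕ} {Γ : Type*} (f : Eucl n × Γ → Eucl n)
    (domf domV : Set (Eucl n × Γ)) (W : Eucl n × Γ → ℝ) : Prop :=
  (∀ γ : Γ, XFwdInf (Ogamma domV domf γ) (fun ξ => f (ξ, γ)) (fun ξ => W (ξ, γ)) ⊆ {0}) ∨
  (∀ γ : Γ, XBwdInf (Ogamma domV domf γ) (fun ξ => f (ξ, γ)) (fun ξ => W (ξ, γ)) ⊆ {0})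

/-- Condition (ii) on simple cycles of `H`. -/
def CondCycle {n : ℕ} {Γ : Type*} (f : Eucl n × Γ → Eucl n)
    (domf domV : Set (Eucl n × Γ)) (W : Eucl n × Γ → ℝ) (H : Γ → Set Γ) : Prop :=
  ∀ m : ℕ, ∀ γs : ℕ → Γ, IsSimpleCycle H m γs →
    ∃ j : ℕ, 1 ≤ j ∧ j < m ∧
      XBwdFin (Ogamma domV domf (γs j)) (fun ξ => f (ξ, γs j)) (fun ξ => W (ξ, γs j)) ∩
      XFwdFin (Ogamma domV domf (γs (j + 1))) (fun ξ => f (ξ, γs (j + 1)))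
        (fun ξ => W (ξ, γs (j + 1))) ⊆ {0}

/-- Condition (iii) on simple cycles of `H`, involving the level sets of `V`. -/
def CondCycle' {n : ℕ} {Γ : Type*} (f : Eucl n × Γ → Eucl n) (V : Eucl n × Γ → ℝ)
    (domf domV : Set (Eucl n × Γ)) (W : Eucl n × Γ → ℝ) (H : Γ → Set Γ) : Prop :=
  ∀ c : ℝ, ∀ m : ℕ, ∀ γs : ℕ → Γ, IsSimpleCycle H m γs →
    ∃ j : ℕ, 1 ≤ j ∧ j < m ∧
      XBwdFin (Ogamma domV domf (γs j)) (fun ξ => f (ξ, γs j)) (fun ξ => W (ξ, γs j)) ∩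
      XFwdFin (Ogamma domV domf (γs (j + 1))) (fun ξ => f (ξ, γs (j + 1)))
        (fun ξ => W (ξ, γs (j + 1))) ∩
      {ξ : Eucl n | V (ξ, γs j) = c} ∩ {ξ : Eucl n | V (ξ, γs (j + 1)) = c} ⊆ {0}

/-- For every `γ`, `O_γ^b(f_γ,W_γ) = E_γ ∩ O_γ` or `O_γ^f(f_γ,W_γ) = E_γ ∩ O_γ`. -/
def CondEquilObs {n : ℕ} {Γ : Type*} (f : Eucl n × Γ → Eucl n)
    (domf domV : Set (Eucl n × Γ)) (W : Eucl n × Γ → ℝ) : Prop :=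
  ∀ γ : Γ,
    XBwdFin (Ogamma domV domf γ) (fun ξ => f (ξ, γ)) (fun ξ => W (ξ, γ)) =
      Egamma f domf γ ∩ Ogamma domV domf γ ∨
    XFwdFin (Ogamma domV domf γ) (fun ξ => f (ξ, γ)) (fun ξ => W (ξ, γ)) =
      Egamma f domf γ ∩ Ogamma domV domf γ

end

section Helpers

lemma aux_lip_limit {E : Type*} [NormedAddCommGroup E] [CompleteSpace E]
    (y : ℕ → ℝ → E) (L : NNReal) (hy : ∀ k, LipschitzWith L (y k)) (g : ℚ → E)
    (hg : ∀ q : ℚ, Tendsto (fun k => y k (q : ℝ)) atTop (𝓝 (g q))) :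
    ∃ X : ℝ → E, Continuous X ∧
      (∀ t, Tendsto (fun k => y k t) atTop (𝓝 (X t))) ∧
      ∀ K : Set ℝ, IsCompact K → TendstoUniformlyOn y X atTop K := by
  have hc : ∀ t, CauchySeq (fun k => y k t) := by
    intro t
    rw [Metric.cauchySeq_iff']
    intro ε hε
    have hL : 0 < (L : ℝ) + 1 := by positivity
    obtain ⟨q, hq1, hq2⟩ := exists_rat_btwn (show t < t + ε / 4 / (L + 1) by
      have : 0 < ε / 4 / ((L : ℝ) + 1) := by positivity
      linarith)
    have hd : ∀ k, dist (y k t) (y k q) ≤ ε / 4 := by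
      intro k
      have h1 := (hy k).dist_le_mul t q
      have h2 : dist t (q : ℝ) ≤ ε / 4 / (L + 1) := by
        rw [Real.dist_eq, abs_sub_comm, abs_of_pos (by linarith)]; linarith
      calc _ ≤ (L : ℝ) * dist t q := h1
        _ ≤ (L + 1) * (ε / 4 / (L + 1)) := by
          gcongr
          linarith
        _ = ε / 4 := by field_simp
    obtain ⟨N, hN⟩ := (Metric.cauchySeq_iff'.1 (hg q).cauchySeq) (ε / 4) (by positivity)
    refine ⟨N, fun n hn => ?_⟩
    have h1 := hd n
    have h2 := hd N
    have h3 := hN n hn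
    have := dist_triangle4 (y n t) (y n q) (y N q) (y N t)
    rw [dist_comm (y N q) (y N t)] at this
    linarith
  choose X hX using fun t => cauchySeq_tendsto_of_complete (hc t)
  have hXL : LipschitzWith L X := by
    refine LipschitzWith.of_dist_le_mul fun s t => ?_
    exact le_of_tendsto ((hX s).dist (hX t)) (Eventually.of_forall fun k => (hy k).dist_le_mul s t)
  refine ⟨X, hXL.continuous, hX, fun K hK => ?_⟩
  have hlu : TendstoLocallyUniformlyOn y X atTop K := by
    rw [Metric.tendstoLocallyUniformlyOn_iff]
    intro ε hε t ht
    have hL : 0 < (L : ℝ) + 1 := by positivity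
    have hδ : 0 < ε / 4 / ((L : ℝ) + 1) := by positivity
    refine ⟨Metric.ball t (ε / 4 / (L + 1)), mem_nhdsWithin_of_mem_nhds (Metric.ball_mem_nhds _ hδ), ?_⟩
    filter_upwards [(Metric.tendsto_nhds.1 (hX t)) (ε / 4) (by positivity)] with k hk s hs
    have hb : (L : ℝ) * dist s t ≤ ε / 4 := by
      have : dist s t ≤ ε / 4 / (L + 1) := (Metric.mem_ball.1 hs).le
      calc (L : ℝ) * dist s t ≤ (L + 1) * (ε / 4 / (L + 1)) := by
            gcongr
            linarith
        _ = ε / 4 := by field_simp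
    have h1 := (hXL.dist_le_mul s t).trans hb
    have h2 := ((hy k).dist_le_mul s t).trans hb
    have := dist_triangle4 (X s) (X t) (y k t) (y k s)
    rw [dist_comm (X t), dist_comm (y k t) (y k s)] at this
    linarith
  exact (tendstoLocallyUniformlyOn_iff_tendstoUniformlyOn_of_compact hK).1 hlu

lemma aux_const_of_locconst {Γ : Type*} (h : ℝ → Γ) (a b : ℝ)
    (H : ∀ t ∈ Ioo a b, ∀ᶠ s in 𝓝 t, h s = h t) :
    ∀ s ∈ Ioo a b, ∀ t ∈ Ioo a b, h s = h t := by
  intro s hs t ht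
  refine (isPreconnected_Ioo (a := a) (b := b)).induction₂ (fun x y => h x = h y) ?_ ?_ ?_ hs ht
  · intro x hx
    exact ((H x hx).filter_mono nhdsWithin_le_nhds).mono fun y hy => hy.symm
  · intro x y z _ _ _ h1 h2; exact h1.trans h2
  · intro x y _ _ h1; exact h1.symm

lemma aux_signal_locconst {Γ : Type*} [MetricSpace Γ] (σ : ℝ → Γ) (hσ : IsSwitchingSignal σ)
    (t : ℝ) (ht : t ∉ JumpTimes σ) : ∀ᶠ s in 𝓝 t, σ s = σ t := by
  have hc : ContinuousAt σ t := by simpa [JumpTimes] using ht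
  obtain ⟨ε, hε, h1⟩ := hσ.rightConst t
  obtain ⟨δ, hδ, h2⟩ := hσ.leftConst t
  have hlim : Tendsto σ (𝓝[<] t) (𝓝 (σ t)) := hc.tendsto.mono_left nhdsWithin_le_nhds
  have hl : ∀ s ∈ Ioo (t - δ) t, σ s = σ t := by
    intro s hs
    refine tendsto_nhds_unique (Tendsto.congr' ?_ (tendsto_const_nhds (f := 𝓝[<] t))) hlim
    filter_upwards [Ioo_mem_nhdsLT (show t - δ < t by linarith)] with u hu
    exact h2 s hs u hu
  filter_upwards [Ioo_mem_nhds (show t - δ < t by linarith) (show t < t + ε by linarith)] with s hs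
  rcases lt_or_ge s t with h | h
  · exact hl s ⟨hs.1, h⟩
  · exact h1 s ⟨h, hs.2⟩

lemma aux_signal_const {Γ : Type*} [MetricSpace Γ] (σ : ℝ → Γ) (hσ : IsSwitchingSignal σ)
    (a b : ℝ) (hJ : ¬ (JumpTimes σ ∩ Ioo a b).Nonempty) :
    ∀ s ∈ Ioo a b, ∀ t ∈ Ioo a b, σ s = σ t := by
  refine aux_const_of_locconst σ a b fun t ht => aux_signal_locconst σ hσ t fun h => hJ ⟨t, h, ht⟩

lemma aux_rat_nhd (t : ℝ) (U : Set ℝ) (hU : U ∈ 𝓝 t) :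
    ∃ q r : ℚ, (q : ℝ) < t ∧ t < r ∧ Ioo (q : ℝ) r ⊆ U := by
  obtain ⟨l, u, ⟨hl, hu⟩, hs⟩ := mem_nhds_iff_exists_Ioo_subset.1 hU
  obtain ⟨q, hq1, hq2⟩ := exists_rat_btwn hl
  obtain ⟨r, hr1, hr2⟩ := exists_rat_btwn hu
  exact ⟨q, r, hq2, hr1, (Ioo_subset_Ioo hq1.le hr2.le).trans hs⟩

lemma aux_card {Γ : Type*} [MetricSpace Γ] (τD : ℝ) (N₀ : ℕ) (σ : ℕ → ℝ → Γ)
    (hσ : ∀ k, σ k ∈ SA Γ τD N₀) (D : Set ℝ)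
    (hD : ∀ t ∈ D, ∀ q r : ℚ, (q : ℝ) < t → t < r →
      ∀ᶠ k in atTop, (JumpTimes (σ k) ∩ Ioo (q : ℝ) r).Nonempty)
    (a b : ℝ) (hab : a < b) (F : Finset ℝ) (hF : (F : Set ℝ) ⊆ D ∩ Ioo a b) :
    (F.card : ℝ) ≤ N₀ + (b - a) / τD := by
  obtain ⟨U, hU, hdis⟩ := F.finite_toSet.t2_separation
  have h1 : ∀ d ∈ F, ∃ V : Set ℝ, V ⊆ U d ∧ V ⊆ Ioo a b ∧
      ∀ᶠ k in atTop, (JumpTimes (σ k) ∩ V).Nonempty := by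
    intro d hd
    have hd' := hF hd
    obtain ⟨q, r, h1, h2, h3⟩ := aux_rat_nhd d (U d ∩ Ioo a b)
      (inter_mem ((hU d).2.mem_nhds (hU d).1) (isOpen_Ioo.mem_nhds hd'.2))
    exact ⟨_, h3.trans inter_subset_left, h3.trans inter_subset_right, hD d hd'.1 q r h1 h2⟩
  choose! V hVU hVab hV using h1
  have h2 : ∀ᶠ k in atTop, ∀ d ∈ F, (JumpTimes (σ k) ∩ V d).Nonempty :=
    (Filter.eventually_all_finset F).2 hV
  obtain ⟨k, hk⟩ := h2.exists
  choose! j hj using hk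
  have hfin : (JumpTimes (σ k) ∩ Ioo a b).Finite :=
    ((hσ k).1.locFinite a b).subset (inter_subset_inter_right _ Ioo_subset_Icc_self)
  have hle : (F : Set ℝ).ncard ≤ (JumpTimes (σ k) ∩ Ioo a b).ncard := by
    refine Set.ncard_le_ncard_of_injOn j ?_ ?_ hfin
    · intro d hd; exact ⟨(hj d hd).1, hVab d hd (hj d hd).2⟩
    · intro d hd e he hde
      by_contra hne
      have := hdis hd he hne
      exact Set.disjoint_left.1 this (hVU d hd (hj d hd).2) (hde ▸ hVU e he (hj e he).2)
  rw [Set.ncard_coe_finset] at hle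
  exact (Nat.cast_le.2 hle).trans ((hσ k).2 a b hab)

lemma aux_finite {S : Set ℝ} {c : ℝ} (h : ∀ F : Finset ℝ, (F : Set ℝ) ⊆ S → (F.card : ℝ) ≤ c) :
    S.Finite := by
  by_contra hS
  obtain ⟨N, hN⟩ := exists_nat_gt c
  obtain ⟨F, hF, hc⟩ := Set.Infinite.exists_subset_card_eq hS N
  have := h F hF
  rw [hc] at this
  linarith

/-- Limit of switching signals, given convergence of values at rationals and of the
presence of jumps in rational intervals. -/
lemma aux_signal_limit {Γ : Type*} [MetricSpace Γ] (τD : ℝ) (N₀ : ℕ) (σ : ℕ → ℝ → Γ)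
    (hσ : ∀ k, σ k ∈ SA Γ τD N₀) (g : ℚ → Γ)
    (hg : ∀ q : ℚ, Tendsto (fun k => σ k (q : ℝ)) atTop (𝓝 (g q)))
    (hJ : ∀ q r : ℚ, (∀ᶠ k in atTop, (JumpTimes (σ k) ∩ Ioo (q : ℝ) r).Nonempty) ∨
      (∀ᶠ k in atTop, ¬ (JumpTimes (σ k) ∩ Ioo (q : ℝ) r).Nonempty)) :
    ∃ s ∈ SA Γ τD N₀, ∀ᵐ t ∂(volume : Measure ℝ), Tendsto (fun k => σ k t) atTop (𝓝 (s t)) := by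
  set D : Set ℝ := {t | ∀ q r : ℚ, (q : ℝ) < t → t < r →
      ∀ᶠ k in atTop, (JumpTimes (σ k) ∩ Ioo (q : ℝ) r).Nonempty} with hDdef
  have hDcard := aux_card τD N₀ σ hσ D (fun t ht => ht)
  have hDfin : ∀ a b : ℝ, (D ∩ Ioo a b).Finite := by
    intro a b
    rcases lt_or_ge a b with hab | hab
    · exact aux_finite (hDcard a b hab)
    · simp [Ioo_eq_empty_of_le hab]
  -- local constancy of the limit off D
  have hloc : ∀ t, t ∉ D → ∃ v : Γ, ∀ᶠ s in 𝓝 t, Tendsto (fun k => σ k s) atTop (𝓝 v) := by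
    intro t ht
    simp only [hDdef, mem_setOf_eq, not_forall] at ht
    obtain ⟨q, r, hq, hr, hn⟩ := ht
    have hn' := (hJ q r).resolve_left hn
    obtain ⟨p, hp1, hp2⟩ := exists_rat_btwn (hq.trans hr)
    refine ⟨g p, ?_⟩
    filter_upwards [Ioo_mem_nhds hq hr] with s hs
    refine (hg p).congr' ?_
    filter_upwards [hn'] with k hk
    exact aux_signal_const (σ k) (hσ k).1 q r hk p ⟨hp1, hp2⟩ s hs
  haveI : Nonempty Γ := ⟨σ 0 0⟩
  choose! h hh using hloc
  have hlim : ∀ t, t ∉ D → Tendsto (fun k => σ k t) atTop (𝓝 (h t)) :=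
    fun t ht => (hh t ht).self_of_nhds
  have hDopen : ∀ t, ∃ ε > (0 : ℝ), ∀ s ∈ Ioo (t - ε) (t + ε), s ≠ t → s ∉ D := by
    intro t
    have hf := (hDfin (t - 1) (t + 1)).subset (diff_subset (t := {t}))
    have h1 : ((D ∩ Ioo (t - 1) (t + 1)) \ {t})ᶜ ∈ 𝓝 t :=
      hf.isClosed.isOpen_compl.mem_nhds (by simp)
    obtain ⟨ε, hε, hsub⟩ := Metric.mem_nhds_iff.1
      (inter_mem h1 (Ioo_mem_nhds (show t - 1 < t by linarith) (show t < t + 1 by linarith)))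
    refine ⟨ε, hε, fun s hs hne hsD => ?_⟩
    rw [Real.ball_eq_Ioo] at hsub
    have := hsub hs
    exact this.1 ⟨⟨hsD, this.2⟩, hne⟩
  have hnD : ∀ t, t ∉ D → ∀ᶠ s in 𝓝 t, s ∉ D := by
    intro t ht
    obtain ⟨ε, hε, H⟩ := hDopen t
    filter_upwards [Ioo_mem_nhds (show t - ε < t by linarith) (show t < t + ε by linarith)] with s hs
    by_cases hst : s = t
    · rwa [hst]
    · exact H s hs hst
  have hhloc : ∀ t, t ∉ D → ∀ᶠ s in 𝓝 t, h s = h t := by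
    intro t ht
    filter_upwards [hh t ht, hnD t ht] with s hs hsD
    exact tendsto_nhds_unique (hlim s hsD) hs
  have hright : ∀ t, ∃ v : Γ, ∃ ε > (0 : ℝ), ∀ s ∈ Ioo t (t + ε), s ∉ D ∧ h s = v := by
    intro t
    obtain ⟨ε, hε, H⟩ := hDopen t
    have hnot : ∀ s ∈ Ioo t (t + ε), s ∉ D := fun s hs =>
      H s ⟨by linarith [hs.1], hs.2⟩ hs.1.ne'
    refine ⟨h (t + ε / 2), ε, hε, fun s hs => ⟨hnot s hs, ?_⟩⟩
    exact aux_const_of_locconst h t (t + ε) (fun u hu => hhloc u (hnot u hu)) s hs _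
      ⟨by linarith, by linarith⟩
  choose S hS using hright
  have hSh : ∀ t, t ∉ D → S t = h t := by
    intro t ht
    obtain ⟨ε, hε, H⟩ := hS t
    have h1 : ∀ᶠ s in 𝓝[>] t, h s = h t := (hhloc t ht).filter_mono nhdsWithin_le_nhds
    have h2 : ∀ᶠ s in 𝓝[>] t, s ∈ Ioo t (t + ε) := Ioo_mem_nhdsGT (by linarith)
    obtain ⟨s, hs1, hs2⟩ := (h1.and h2).exists
    rw [← hs1, (H s hs2).2]
  have hjump : JumpTimes S ⊆ D := by
    intro t ht
    by_contra htD
    apply ht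
    have : ∀ᶠ s in 𝓝 t, S s = S t := by
      filter_upwards [hhloc t htD, hnD t htD] with s hs hsD
      rw [hSh s hsD, hSh t htD, hs]
    exact continuousAt_const.congr (this.mono fun s hs => hs.symm)
  refine ⟨S, ⟨⟨?_, ?_, ?_⟩, ?_⟩, ?_⟩
  · intro a b
    refine (hDfin (a - 1) (b + 1)).subset ?_
    rintro t ⟨h1, h2⟩
    exact ⟨hjump h1, by linarith [h2.1], by linarith [h2.2]⟩
  · intro t
    obtain ⟨ε, hε, H⟩ := hS t
    refine ⟨ε, hε, fun s hs => ?_⟩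
    rcases hs.1.eq_or_lt with he | hlt
    · rw [he]
    · have := H s ⟨hlt, hs.2⟩
      rw [hSh s this.1, this.2]
  · intro t
    obtain ⟨ε, hε, H⟩ := hDopen t
    have hnot : ∀ s ∈ Ioo (t - ε) t, s ∉ D := fun s hs =>
      H s ⟨hs.1, by linarith [hs.2]⟩ hs.2.ne
    refine ⟨ε, hε, fun s hs s' hs' => ?_⟩
    rw [hSh s (hnot s hs), hSh s' (hnot s' hs')]
    exact aux_const_of_locconst h (t - ε) t (fun u hu => hhloc u (hnot u hu)) s hs s' hs'
  · intro a b hab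
    have h1 := hDfin a b
    have h2 : (JumpTimes S ∩ Ioo a b).ncard ≤ (D ∩ Ioo a b).ncard :=
      Set.ncard_le_ncard (inter_subset_inter_left _ hjump) h1
    have h3 := hDcard a b hab h1.toFinset (by simp)
    rw [← Set.ncard_eq_toFinset_card _ h1] at h3
    exact (Nat.cast_le.2 h2).trans h3
  · have hDc : D.Countable := by
      have : D = ⋃ m : ℕ, D ∩ Ioo (-(m : ℝ)) m := by
        rw [← inter_iUnion]
        refine (inter_eq_left.2 fun t _ => ?_).symm
        obtain ⟨m, hm⟩ := exists_nat_gt |t|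
        exact mem_iUnion.2 ⟨m, abs_lt.1 hm⟩
      rw [this]
      exact countable_iUnion fun m => (hDfin _ _).countable
    filter_upwards [hDc.ae_notMem volume] with t ht
    rw [hSh t ht]
    exact hlim t ht

end Helpers

noncomputable section
theorem trajectory_compactness_complete
    {n : ℕ} {Γ : Type*} [MetricSpace Γ] [CompactSpace Γ]
    (f : Eucl n × Γ → Eucl n) (domf : Set (Eucl n × Γ))
    (hdomf : IsClosed domf) (hf : ContinuousOn f domf)
    (τD : ℝ) (hτD : 0 < τD) (N₀ : ℕ)
    (xk : ℕ → ℝ → Eucl n) (σk : ℕ → ℝ → Γ) (Ik : ℕ → Set ℝ)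
    (htraj : ∀ k, IsTrajectory f domf (xk k) (σk k) (Ik k))
    (hIk : ∀ k : ℕ, Set.Ici (-(k : ℝ)) ⊆ Ik k)
    (hσ : ∀ k, σk k ∈ SA Γ τD N₀)
    (B : Set (Eucl n)) (hB : IsCompact B)
    (hbd : ∀ k, ∀ t ∈ Ik k, xk k t ∈ B) :
    ∃ φ : ℕ → ℕ, StrictMono φ ∧ ∃ xstar : ℝ → Eucl n, ∃ σstar : ℝ → Γ,
      IsTrajectory f domf xstar σstar Set.univ ∧ σstar ∈ SA Γ τD N₀ ∧
      (∀ K : Set ℝ, IsCompact K →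
        TendstoUniformlyOn (fun l => xk (φ l)) xstar Filter.atTop K) ∧
      ∀ᵐ t ∂(volume : Measure ℝ),
        Filter.Tendsto (fun l => σk (φ l) t) Filter.atTop (nhds (σstar t)) := by
  classical
  -- uniform bound on the vector field
  have hcomp : IsCompact (domf ∩ (B ×ˢ (Set.univ : Set Γ))) :=
    (hB.prod isCompact_univ).inter_left hdomf
  obtain ⟨L₀, hL₀⟩ := hcomp.exists_bound_of_continuousOn (hf.mono inter_subset_left)
  set L : NNReal := Real.toNNReal L₀ with hLdef
  have hbound : ∀ k, ∀ t ∈ Ik k, ‖f (xk k t, σk k t)‖ ≤ L := fun k t ht =>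
    (hL₀ _ ⟨(htraj k).mem t ht, hbd k t ht, mem_univ _⟩).trans (Real.le_coe_toNNReal _)
  have hxlip : ∀ k, ∀ s ∈ Ik k, ∀ t ∈ Ik k, dist (xk k s) (xk k t) ≤ L * |s - t| := by
    intro k s hs t ht
    have h1 := ((htraj k).intg t ht s hs).2
    rw [dist_eq_norm, h1, add_sub_cancel_left]
    refine intervalIntegral.norm_integral_le_of_norm_le_const fun u hu => hbound k u ?_
    exact (htraj k).ordConn.uIcc_subset ht hs (uIoc_subset_uIcc hu)
  set y : ℕ → ℝ → Eucl n := fun k t => xk k (max t (-(k : ℝ))) with hydef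
  have hmem : ∀ k t, max t (-(k : ℝ)) ∈ Ik k := fun k t => hIk k (mem_Ici.2 (le_max_right _ _))
  have hylip : ∀ k, LipschitzWith L (y k) := by
    intro k
    refine LipschitzWith.of_dist_le_mul fun s t => ?_
    refine (hxlip k _ (hmem k s) _ (hmem k t)).trans ?_
    rw [Real.dist_eq]
    refine mul_le_mul_of_nonneg_left ?_ L.2
    exact abs_max_sub_max_le_abs s t _
  have hyB : ∀ k t, y k t ∈ B := fun k t => hbd k _ (hmem k t)
  -- diagonal subsequence
  haveI : CompactSpace B := isCompact_iff_compactSpace.1 hB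
  let Z : ℕ → (ℚ → B) × (ℚ → Γ) × (ℚ × ℚ → Bool) := fun k =>
    (fun q => ⟨y k q, hyB k q⟩, fun q => σk k q,
      fun p => decide ((JumpTimes (σk k) ∩ Ioo (p.1 : ℝ) p.2).Nonempty))
  obtain ⟨z, φ, hφ, hz⟩ := SeqCompactSpace.tendsto_subseq Z
  have hz1 : ∀ q : ℚ, Tendsto (fun l => y (φ l) q) atTop (𝓝 (z.1 q : Eucl n)) := by
    intro q
    have h1 : Continuous fun w : (ℚ → B) × (ℚ → Γ) × (ℚ × ℚ → Bool) => ((w.1 q : B) : Eucl n) := by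
      fun_prop
    exact (h1.tendsto z).comp hz
  have hz2 : ∀ q : ℚ, Tendsto (fun l => σk (φ l) q) atTop (𝓝 (z.2.1 q)) := by
    intro q
    have h1 : Continuous fun w : (ℚ → B) × (ℚ → Γ) × (ℚ × ℚ → Bool) => w.2.1 q := by
      fun_prop
    exact (h1.tendsto z).comp hz
  have hz3 : ∀ q r : ℚ,
      (∀ᶠ l in atTop, (JumpTimes (σk (φ l)) ∩ Ioo (q : ℝ) r).Nonempty) ∨
      (∀ᶠ l in atTop, ¬ (JumpTimes (σk (φ l)) ∩ Ioo (q : ℝ) r).Nonempty) := by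
    intro q r
    have h1 : Continuous fun w : (ℚ → B) × (ℚ → Γ) × (ℚ × ℚ → Bool) => w.2.2 (q, r) := by
      fun_prop
    have h2 := (h1.tendsto z).comp hz
    rw [nhds_discrete, tendsto_pure] at h2
    cases hb : z.2.2 (q, r) with
    | true =>
      left
      filter_upwards [h2] with l hl
      rw [hb] at hl
      exact of_decide_eq_true hl
    | false =>
      right
      filter_upwards [h2] with l hl
      rw [hb] at hl
      exact of_decide_eq_false hl
  obtain ⟨xs, hxc, hxt, hxu⟩ := aux_lip_limit (fun l => y (φ l)) L (fun l => hylip _) _ hz1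
  obtain ⟨S, hSA, hSlim⟩ := aux_signal_limit τD N₀ (fun l => σk (φ l)) (fun l => hσ _) _ hz2 hz3
  have hev : ∀ a : ℝ, ∀ᶠ l in atTop, -((φ l : ℕ) : ℝ) ≤ a := by
    intro a
    have : Tendsto (fun l => ((φ l : ℕ) : ℝ)) atTop atTop :=
      tendsto_natCast_atTop_atTop.comp hφ.tendsto_atTop
    filter_upwards [this.eventually_ge_atTop (-a)] with l hl
    linarith
  have hyx : ∀ l t, -((φ l : ℕ) : ℝ) ≤ t → y (φ l) t = xk (φ l) t := by
    intro l t h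
    simp only [hydef, max_eq_left h]
  have hxt' : ∀ t, Tendsto (fun l => xk (φ l) t) atTop (𝓝 (xs t)) := by
    intro t
    refine (hxt t).congr' ?_
    filter_upwards [hev t] with l hl
    exact hyx l t hl
  have hpair : ∀ᵐ t ∂(volume : Measure ℝ),
      Tendsto (fun l => (xk (φ l) t, σk (φ l) t)) atTop (𝓝 (xs t, S t)) := by
    filter_upwards [hSlim] with t ht
    exact (hxt' t).prodMk_nhds ht
  have hdomev : ∀ t, ∀ᶠ l in atTop, (xk (φ l) t, σk (φ l) t) ∈ domf := by
    intro t
    filter_upwards [hev t] with l hl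
    exact (htraj (φ l)).mem t (hIk _ (mem_Ici.2 hl))
  have hmemae : ∀ᵐ t ∂(volume : Measure ℝ), (xs t, S t) ∈ domf := by
    filter_upwards [hpair] with t ht
    exact hdomf.mem_of_tendsto ht (hdomev t)
  have hmemall : ∀ t, (xs t, S t) ∈ domf := by
    intro t
    obtain ⟨ε, hε, H⟩ := hSA.1.rightConst t
    have h1 : Tendsto (fun s => (xs s, S t)) (𝓝[>] t) (𝓝 (xs t, S t)) :=
      ((hxc.tendsto t).mono_left nhdsWithin_le_nhds).prodMk_nhds tendsto_const_nhds
    refine hdomf.mem_of_frequently_of_tendsto ?_ h1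
    rw [(nhdsGT_basis t).frequently_iff]
    intro b hb
    have hlt : t < min b (t + ε) := lt_min hb (by linarith)
    have hpos : volume (Ioo t (min b (t + ε))) ≠ 0 := by
      rw [Real.volume_Ioo]
      simp only [ne_eq, ENNReal.ofReal_eq_zero, not_le]
      linarith
    obtain ⟨s, hs, hsd⟩ : ∃ s ∈ Ioo t (min b (t + ε)), (xs s, S s) ∈ domf := by
      by_contra hcon
      push Not at hcon
      apply hpos
      exact measure_mono_null (fun s hs => hcon s hs) hmemae
    refine ⟨s, ⟨hs.1, hs.2.trans_le (min_le_left _ _)⟩, ?_⟩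
    rwa [H s ⟨hs.1.le, hs.2.trans_le (min_le_right _ _)⟩] at hsd
  have hflim : ∀ᵐ t ∂(volume : Measure ℝ),
      Tendsto (fun l => f (xk (φ l) t, σk (φ l) t)) atTop (𝓝 (f (xs t, S t))) := by
    filter_upwards [hpair] with t ht
    exact (hf (xs t, S t) (hmemall t)).tendsto.comp
      (tendsto_nhdsWithin_iff.2 ⟨ht, hdomev t⟩)
  have hxB : ∀ t, xs t ∈ B := fun t =>
    hB.isClosed.mem_of_tendsto (hxt t) (Eventually.of_forall fun l => hyB _ t)
  have hfb : ∀ t, ‖f (xs t, S t)‖ ≤ L := fun t =>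
    (hL₀ _ ⟨hmemall t, hxB t, mem_univ _⟩).trans (Real.le_coe_toNNReal _)
  refine ⟨φ, hφ, xs, S, ⟨hSA.1, univ_nonempty, ordConnected_univ, hxc.continuousOn,
    fun t _ => hmemall t, ?_⟩, hSA, ?_, hSlim⟩
  · intro a _ b _
    have hab : ∀ᶠ l in atTop, a ∈ Ik (φ l) ∧ b ∈ Ik (φ l) := by
      filter_upwards [hev a, hev b] with l h1 h2
      exact ⟨hIk _ (mem_Ici.2 h1), hIk _ (mem_Ici.2 h2)⟩
    have hmeas : ∀ᶠ l in atTop, AEStronglyMeasurable (fun s => f (xk (φ l) s, σk (φ l) s))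
        (volume.restrict (Set.uIoc a b)) := by
      filter_upwards [hab] with l hl
      exact ((htraj (φ l)).intg a hl.1 b hl.2).1.def'.aestronglyMeasurable
    have hmeas' : AEStronglyMeasurable (fun s => f (xs s, S s)) (volume.restrict (Set.uIoc a b)) := by
      obtain ⟨N, hN⟩ := eventually_atTop.1 hmeas
      refine aestronglyMeasurable_of_tendsto_ae atTop (fun l => hN (l + N) (by omega)) ?_
      filter_upwards [ae_restrict_of_ae hflim] with t ht
      exact ht.comp (tendsto_add_atTop_nat N)
    have hint : IntervalIntegrable (fun s => f (xs s, S s)) volume a b :=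
      (intervalIntegrable_const (c := (L : ℝ))).mono_fun hmeas'
        (Eventually.of_forall fun t => (hfb t).trans (le_abs_self _))
    refine ⟨hint, ?_⟩
    have hI : Tendsto (fun l => ∫ s in a..b, f (xk (φ l) s, σk (φ l) s)) atTop
        (𝓝 (∫ s in a..b, f (xs s, S s))) := by
      refine intervalIntegral.tendsto_integral_filter_of_dominated_convergence (fun _ => (L : ℝ))
        hmeas ?_ intervalIntegrable_const ?_
      · filter_upwards [hab] with l hl
        refine Eventually.of_forall fun t ht => hbound _ t ?_
        exact (htraj _).ordConn.uIcc_subset hl.1 hl.2 (uIoc_subset_uIcc ht)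
      · filter_upwards [hflim] with t ht _
        exact ht
    refine tendsto_nhds_unique (hxt' b) (((hxt' a).add hI).congr' ?_)
    filter_upwards [hab] with l hl
    exact ((htraj (φ l)).intg a hl.1 b hl.2).2.symm
  · intro K hK
    obtain ⟨m, hm⟩ := hK.bddBelow
    refine (hxu K hK).congr ?_
    filter_upwards [hev m] with l hl t ht
    exact hyx l t (hl.trans (hm ht))
end
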